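/- arXiv:1101.1112 — 2 statements merged into one kernel-verified Lean document; each statement's English description precedes it below -/
import Mathlib

section
/- Let R be an integral domain with field of fractions K, and let p be a prime ideal of R of height one. Then there exists a Mathieu subspace M of K over R such that p is exactly the preimage of M under the canonical map R → K, i.e. p = {r ∈ R | the image of r in K lies in M}. -/
/-- `M` is a Mathieu subspace of `K` over `R`. -/
def IsMathieuSub {R K : Type*} [CommRing R] [CommRing K] [Algebra R K]
    (M : Submodule R K) : Prop :=
  ∀ a b : K, (∀ m : ℕ, 1 ≤ m → a ^ m ∈ M) →
    ∃ N : ℕ, ∀ m : ℕ, N ≤ m → b * a ^ m ∈ M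

/-- `p` is a prime ideal of height one: it is a nonzero prime ideal and every
prime ideal strictly contained in it is zero. -/
def HeightOnePrime {R : Type*} [CommRing R] (p : Ideal R) : Prop :=
  p.IsPrime ∧ p ≠ ⊥ ∧ ∀ q : Ideal R, q.IsPrime → q < p → q = ⊥

/-- If `p` is a prime of height one, `a ∈ p` and `s ≠ 0`, then some power of `a` is divisible
by `s` in the localization at `p`. -/
theorem HeightOnePrime.exists_dvd_mul_pow {R : Type*} [CommRing R] {p : Ideal R}
    (hp : HeightOnePrime p) {a s : R} (ha : a ∈ p) (hs : s ≠ 0) :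
    ∃ t, t ∉ p ∧ ∃ n : ℕ, s ∣ t * a ^ n := by
  have := hp.1
  by_contra! h
  have hdisj : Disjoint (Ideal.span {s} : Set R)
      ((p.primeCompl ⊔ Submonoid.powers a : Submonoid R) : Set R) := by
    rw [Set.disjoint_left]
    intro x hx hx'
    obtain ⟨t, ht, _, ⟨n, rfl⟩, rfl⟩ := Submonoid.mem_sup.1 hx'
    exact h t ht n (Ideal.mem_span_singleton.1 hx)
  obtain ⟨q, hq, hsq, hqd⟩ := Ideal.exists_le_prime_disjoint _ _ hdisj
  rw [Set.disjoint_left] at hqd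
  have hqp : q ≤ p := fun x hx => by
    by_contra hxp
    exact hqd hx (Submonoid.mem_sup_left (S := p.primeCompl) hxp)
  have haq : a ∉ q := fun haq =>
    hqd haq (Submonoid.mem_sup_right (Submonoid.mem_powers a))
  have hbot := hp.2.2 q hq (lt_of_le_of_ne hqp fun e => haq (e ▸ ha))
  have hs' : s ∈ q := hsq (Ideal.mem_span_singleton_self s)
  rw [hbot] at hs'
  exact hs hs'

/-- The maximal ideal `p Rₚ` of the localization of `R` at `p`, as an `R`-submodule of an
`R`-algebra `K`. -/
def primeFractions {R : Type*} (K : Type*) [CommRing R] [CommRing K] [Algebra R K]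
    (p : Ideal R) [p.IsPrime] : Submodule R K where
  carrier := {x | ∃ r ∈ p, ∃ s, s ∉ p ∧ x * algebraMap R K s = algebraMap R K r}
  zero_mem' := ⟨0, p.zero_mem, 1, p.one_notMem, by simp⟩
  add_mem' := by
    rintro x y ⟨r, hr, s, hs, hx⟩ ⟨r', hr', s', hs', hy⟩
    refine ⟨r * s' + r' * s, p.add_mem (p.mul_mem_right _ hr) (p.mul_mem_right _ hr'), s * s',
      p.primeCompl.mul_mem hs hs', ?_⟩
    simp only [map_add, map_mul, ← hx, ← hy]
    ring
  smul_mem' := by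
    rintro c x ⟨r, hr, s, hs, hx⟩
    refine ⟨c * r, p.mul_mem_left _ hr, s, hs, ?_⟩
    rw [Algebra.smul_def, mul_assoc, hx, map_mul]

theorem algebraMap_mem_primeFractions {R K : Type*} [CommRing R] [CommRing K] [Algebra R K]
    [FaithfulSMul R K] (p : Ideal R) [hp : p.IsPrime] {r : R} :
    algebraMap R K r ∈ primeFractions K p ↔ r ∈ p := by
  constructor
  · rintro ⟨r', hr', s, hs, h⟩
    rw [← map_mul] at h
    have h' := FaithfulSMul.algebraMap_injective R K h
    exact (hp.mem_or_mem (h' ▸ hr' : r * s ∈ p)).resolve_right hs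
  · exact fun hr => ⟨r, hr, 1, p.one_notMem, by simp⟩

theorem isMathieuSub_primeFractions {R K : Type*} [CommRing R] [IsDomain R] [Field K]
    [Algebra R K] [IsFractionRing R K] {p : Ideal R} [p.IsPrime] (hp : HeightOnePrime p) :
    IsMathieuSub (primeFractions K p) := by
  intro a b ha
  obtain ⟨r, hr, s, hs, hx⟩ := ha 1 le_rfl
  rw [pow_one] at hx
  obtain ⟨⟨c, d⟩, hb⟩ := IsLocalization.surj (nonZeroDivisors R) b
  obtain ⟨t, ht, n, u, hu⟩ := hp.exists_dvd_mul_pow hr (nonZeroDivisors.coe_ne_zero d)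
  refine ⟨n + 1, fun m hm => ?_⟩
  obtain ⟨k, rfl⟩ := Nat.exists_eq_add_of_le hm
  refine ⟨c * u * r ^ k * r, p.mul_mem_left _ hr, t * s ^ (n + 1 + k),
    p.primeCompl.mul_mem ht (p.primeCompl.pow_mem hs _), ?_⟩
  have hu' := congrArg (algebraMap R K) hu
  simp only [map_mul, map_pow] at hu' hb ⊢
  rw [← hb]
  calc b * a ^ (n + 1 + k) * (algebraMap R K t * algebraMap R K s ^ (n + 1 + k))
      = b * algebraMap R K t * (a * algebraMap R K s) ^ (n + 1 + k) := by rw [mul_pow]; ring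
    _ = b * (algebraMap R K t * algebraMap R K r ^ n) * algebraMap R K r ^ k
          * algebraMap R K r := by rw [hx]; ring
    _ = _ := by rw [hu']; ring

theorem heightOnePrime_eq_contraction_of_mathieu {R : Type*} [CommRing R] [IsDomain R]
    (p : Ideal R) (hp : HeightOnePrime p) :
    ∃ M : Submodule R (FractionRing R), IsMathieuSub M ∧
      ∀ r : R, r ∈ p ↔ algebraMap R (FractionRing R) r ∈ M := by
  have := hp.1
  exact ⟨primeFractions (FractionRing R) p, isMathieuSub_primeFractions hp,
    fun _ => (algebraMap_mem_primeFractions p).symm⟩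
end

section
/- Let R be an integral domain with field of fractions K. (a) If r ∈ R is anti-Archimedean, i.e. ⋂_{n ≥ 1} r^n R ≠ (0), then every Mathieu subspace M of K over R that contains the image of r in K equals K. (b) Consequently, if every nonzero element of R is anti-Archimedean, then the only Mathieu subspaces of K over R are (0) and K; and if the only Mathieu subspaces of K over R are (0) and K, then R has no prime ideal of height one. -/
/-- `r` is anti-Archimedean: the intersection of the ideals `r ^ n R`, `n ≥ 1`,
is nonzero. -/
def AntiArchimedean {R : Type*} [CommRing R] (r : R) : Prop :=
  ∃ x : R, x ≠ 0 ∧ ∀ n : ℕ, 1 ≤ n → r ^ n ∣ x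

theorem IsMathieuSub.eq_top_of_antiArchimedean {R K : Type*} [CommRing R] [Field K] [Algebra R K]
    [FaithfulSMul R K] {M : Submodule R K} (hM : IsMathieuSub M) {r : R}
    (hr : AntiArchimedean r) (hrM : algebraMap R K r ∈ M) : M = ⊤ := by
  obtain ⟨x, hx, hdvd⟩ := hr
  have hx' : algebraMap R K x ≠ 0 := by simpa using hx
  refine eq_top_iff.mpr fun c _ ↦ ?_
  have hpow (m : ℕ) (hm : 1 ≤ m) : algebraMap R K r ^ m ∈ M := by
    obtain ⟨k, rfl⟩ := Nat.exists_eq_add_of_le' hm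
    simpa [Algebra.smul_def, pow_succ] using M.smul_mem (r ^ k) hrM
  obtain ⟨N, hN⟩ := hM _ (c / algebraMap R K x) hpow
  obtain ⟨y, hy⟩ := hdvd (N + 1) (by lia)
  have hmem := M.smul_mem y (hN (N + 1) (by lia))
  have hc : y • (c / algebraMap R K x * algebraMap R K r ^ (N + 1)) = c := by
    have hxy : algebraMap R K x = algebraMap R K r ^ (N + 1) * algebraMap R K y := by
      rw [hy, map_mul, map_pow]
    rw [Algebra.smul_def, mul_comm, mul_assoc, ← hxy, div_mul_cancel₀ _ hx']
  rwa [hc] at hmem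

/-- Over a height one prime, some power of every element of `p` becomes divisible by any given
nonzero `y` after multiplication by an element outside `p`. -/
theorem HeightOnePrime.exists_dvd_pow_mul {R : Type*} [CommRing R] {p : Ideal R}
    (hp : HeightOnePrime p) {c : R} (hc : c ∈ p) {y : R} (hy : y ≠ 0) :
    ∃ (n : ℕ) (s : R), s ∉ p ∧ y ∣ c ^ n * s := by
  obtain ⟨hprime, -, hmin⟩ := hp
  by_contra! h
  obtain ⟨q, hq, hyq, hdisj⟩ := Ideal.exists_le_prime_disjoint (Ideal.span {y})
    (Submonoid.powers c ⊔ p.primeCompl) <| by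
      refine Set.disjoint_left.mpr fun t ht ht' ↦ ?_
      obtain ⟨_, ⟨n, rfl⟩, s, hs, rfl⟩ := Submonoid.mem_sup.mp ht'
      exact h n s hs (Ideal.mem_span_singleton.mp ht)
  have hcq : c ∉ q := fun hcq ↦ Set.disjoint_left.mp hdisj hcq
    ((le_sup_left : Submonoid.powers c ≤ Submonoid.powers c ⊔ p.primeCompl)
      (Submonoid.mem_powers c))
  have hqp : q ≤ p := fun t ht ↦ by
    by_contra htp
    exact Set.disjoint_left.mp hdisj ht
      ((le_sup_right : p.primeCompl ≤ Submonoid.powers c ⊔ p.primeCompl) htp)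
  have hbot := hmin q hq (lt_of_le_of_ne hqp fun h ↦ hcq (h ▸ hc))
  have hyq' := hyq (Ideal.mem_span_singleton_self y)
  rw [hbot] at hyq'
  exact hy hyq'

/-- The maximal ideal of the localization of `R` at `p`, as an `R`-submodule of `K`. -/
def Ideal.localizedMaximal {R : Type*} (K : Type*) [CommRing R] [CommRing K] [Algebra R K]
    (p : Ideal R) [p.IsPrime] : Submodule R K where
  carrier := {x | ∃ c ∈ p, ∃ s ∉ p, x * algebraMap R K s = algebraMap R K c}
  zero_mem' := ⟨0, p.zero_mem, 1, p.one_notMem, by simp⟩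
  add_mem' := by
    rintro x y ⟨c, hc, s, hs, hx⟩ ⟨d, hd, t, ht, hy⟩
    refine ⟨c * t + d * s, p.add_mem (p.mul_mem_right _ hc) (p.mul_mem_right _ hd), s * t,
      p.primeCompl.mul_mem hs ht, ?_⟩
    simp only [map_add, map_mul, ← hx, ← hy]
    ring
  smul_mem' := by
    rintro r x ⟨c, hc, s, hs, hx⟩
    refine ⟨r * c, p.mul_mem_left _ hc, s, hs, ?_⟩
    rw [Algebra.smul_def, map_mul, ← hx, mul_assoc]

theorem HeightOnePrime.isMathieuSub_localizedMaximal {R K : Type*} [CommRing R] [IsDomain R]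
    [Field K] [Algebra R K] [IsFractionRing R K] {p : Ideal R} [p.IsPrime]
    (hp : HeightOnePrime p) : IsMathieuSub (p.localizedMaximal K) := by
  intro a b ha
  obtain ⟨c, hc, s, hs, has⟩ : a ∈ p.localizedMaximal K := by simpa using ha 1 le_rfl
  obtain ⟨⟨x, y⟩, hxy⟩ := IsLocalization.surj (nonZeroDivisors R) b
  obtain ⟨n, t, ht, z, hz⟩ := hp.exists_dvd_pow_mul hc (nonZeroDivisors.ne_zero y.2)
  refine ⟨n + 1, fun m hm ↦ ?_⟩
  obtain ⟨k, rfl⟩ := Nat.exists_eq_add_of_le hm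
  refine ⟨x * z * c ^ (k + 1), p.mul_mem_left _ (p.pow_mem_of_mem hc _ (by lia)),
    s ^ (n + 1 + k) * t, p.primeCompl.mul_mem (p.primeCompl.pow_mem hs _) ht, ?_⟩
  have hz' := congrArg (algebraMap R K) hz
  simp only [map_mul, map_pow] at hz' hxy ⊢
  calc b * a ^ (n + 1 + k) * (algebraMap R K s ^ (n + 1 + k) * algebraMap R K t)
      = b * (a * algebraMap R K s) ^ (n + 1 + k) * algebraMap R K t := by ring
    _ = b * (algebraMap R K c ^ n * algebraMap R K t) * algebraMap R K c ^ (k + 1) := by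
      rw [has]; ring
    _ = algebraMap R K x * algebraMap R K z * algebraMap R K c ^ (k + 1) := by
      rw [hz', ← hxy]; ring

theorem antiArchimedean_strongly_simple {R : Type*} [CommRing R] [IsDomain R] :
    (∀ r : R, AntiArchimedean r →
      ∀ M : Submodule R (FractionRing R), IsMathieuSub M →
        algebraMap R (FractionRing R) r ∈ M → M = ⊤) ∧
    ((∀ r : R, r ≠ 0 → AntiArchimedean r) →
      ∀ M : Submodule R (FractionRing R), IsMathieuSub M → M = ⊥ ∨ M = ⊤) ∧
    ((∀ M : Submodule R (FractionRing R), IsMathieuSub M → M = ⊥ ∨ M = ⊤) →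
      ¬ ∃ p : Ideal R, HeightOnePrime p) := by
  refine ⟨fun r hr M hM hrM ↦ hM.eq_top_of_antiArchimedean hr hrM, fun hR M hM ↦ ?_, ?_⟩
  · refine or_iff_not_imp_left.mpr fun hbot ↦ ?_
    obtain ⟨a, haM, ha⟩ := M.exists_mem_ne_zero_of_ne_bot hbot
    obtain ⟨⟨x, y⟩, hxy⟩ := IsLocalization.surj (nonZeroDivisors R) a
    have hxM : algebraMap R (FractionRing R) x ∈ M := by
      rw [← hxy, mul_comm, ← Algebra.smul_def]
      exact M.smul_mem _ haM
    refine hM.eq_top_of_antiArchimedean (hR x ?_) hxM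
    rintro rfl
    simp [ha] at hxy
  · rintro hR ⟨p, hp⟩
    have hprime := hp.1
    rcases hR _ (hp.isMathieuSub_localizedMaximal (K := FractionRing R)) with h | h
    · obtain ⟨c, hc, hc0⟩ := p.exists_mem_ne_zero_of_ne_bot hp.2.1
      have hmem : algebraMap R (FractionRing R) c ∈ p.localizedMaximal (FractionRing R) :=
        ⟨c, hc, 1, p.one_notMem, by simp⟩
      rw [h] at hmem
      exact hc0 (by simpa using hmem)
    · obtain ⟨c, hc, s, hs, hsc⟩ : (1 : FractionRing R) ∈ p.localizedMaximal (FractionRing R) :=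
        h ▸ Submodule.mem_top
      rw [one_mul] at hsc
      exact hs (IsFractionRing.injective R (FractionRing R) hsc ▸ hc)
end
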